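/- Let q be a prime power. Every (2×4)-system L over F_q with s(L) = 3 is uncommon. -/

import Mathlib

open Finset

section Defs

variable {F : Type} [Field F] [Fintype F] [DecidableEq F]

/-- The set of solutions to `L x = 0` with all coordinates in `A ⊆ F^n`. -/
def solSet {m k n : ℕ} (L : Matrix (Fin m) (Fin k) F) (A : Set (Fin n → F)) :
    Set (Fin k → Fin n → F) :=
  {x | (∀ j, x j ∈ A) ∧ ∀ i, ∑ j, L i j • x j = 0}

/-- The finset of all solutions to `L x = 0` over `F^n`. -/
def solutions {m k : ℕ} (L : Matrix (Fin m) (Fin k) F) (n : ℕ) :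
    Finset (Fin k → Fin n → F) :=
  Finset.univ.filter fun x => ∀ i, ∑ j, L i j • x j = 0

/-- `Λ_L(f)`, the density of solutions to `L = 0` with respect to `f`. -/
noncomputable def lambdaSol {m k n : ℕ} (L : Matrix (Fin m) (Fin k) F) (f : (Fin n → F) → ℝ) : ℝ :=
  (∑ x ∈ solutions L n, ∏ j, f (x j)) / (solutions L n).card

/-- `Δ_L(f) = Λ_L(1/2 + f) + Λ_L(1/2 − f)`. -/
noncomputable def deltaSol {m k n : ℕ} (L : Matrix (Fin m) (Fin k) F) (f : (Fin n → F) → ℝ) : ℝ :=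
  lambdaSol L (fun y => 1 / 2 + f y) + lambdaSol L (fun y => 1 / 2 - f y)

/-- `L` is common: for every `n ≥ 1` and every `f : F^n → [-1/2,1/2]`,
`Δ_L(f) ≥ 2^(1-k)`. -/
def IsCommon {m k : ℕ} (L : Matrix (Fin m) (Fin k) F) : Prop :=
  ∀ n : ℕ, 1 ≤ n → ∀ f : (Fin n → F) → ℝ,
    (∀ y, f y ∈ Set.Icc (-(1 / 2) : ℝ) (1 / 2)) →
    (2 : ℝ) ^ (1 - (k : ℤ)) ≤ deltaSol L f

/-- The rows of the coefficient matrix `L` are linearly independent. -/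
def RowsIndep {m k : ℕ} (L : Matrix (Fin m) (Fin k) F) : Prop :=
  LinearIndependent F fun i => fun j => L i j

/-- `L` induces the `ℓ`-variable system `L'` on the set `B` (with `B` listed in
increasing order). -/
def InducesOn {m k m' ℓ : ℕ} (L : Matrix (Fin m) (Fin k) F)
    (L' : Matrix (Fin m') (Fin ℓ) F) (B : Finset (Fin k)) (hB : B.card = ℓ) : Prop :=
  ∀ x : Fin k → F, (∀ i, ∑ j, L i j * x j = 0) →
    ∀ r, ∑ t, L' r t * x (B.orderIsoOfFin hB t).1 = 0

/-- `L` is irredundant: it does not induce the equation `x i − x j = 0` for any `i ≠ j`. -/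
def IsIrredundant {m k : ℕ} (L : Matrix (Fin m) (Fin k) F) : Prop :=
  ¬ ∃ i j : Fin k, i ≠ j ∧
    ∀ x : Fin k → F, (∀ r, ∑ t, L r t * x t = 0) → x i = x j

/-- `c` is a (single) linear equation induced by `L`. -/
def InducedEq {m k : ℕ} (L : Matrix (Fin m) (Fin k) F) (c : Fin k → F) : Prop :=
  ∀ x : Fin k → F, (∀ i, ∑ j, L i j * x j = 0) → ∑ j, c j * x j = 0

/-- Length of an equation: the number of variables with nonzero coefficient. -/
def eqLength {k : ℕ} (c : Fin k → F) : ℕ := (Finset.univ.filter fun j => c j ≠ 0).card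

/-- `s(L)`: the minimal length of a nonzero equation induced by `L`. -/
noncomputable def sMin {m k : ℕ} (L : Matrix (Fin m) (Fin k) F) : ℕ :=
  sInf {s | ∃ c : Fin k → F, c ≠ 0 ∧ InducedEq L c ∧ eqLength c = s}

/-- `c(L)`: `s(L)` rounded up to the nearest even number. -/
noncomputable def cEven {m k : ℕ} (L : Matrix (Fin m) (Fin k) F) : ℕ :=
  if Even (sMin L) then sMin L else sMin L + 1

/-- `B` is a critical set for `L`: `|B| = c(L)` and `L` induces some system on `B`. -/
def IsCriticalSet {m k : ℕ} (L : Matrix (Fin m) (Fin k) F) (B : Finset (Fin k)) : Prop :=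
  B.card = cEven L ∧ ∃ (m' : ℕ) (L' : Matrix (Fin m') (Fin B.card) F),
    1 ≤ m' ∧ RowsIndep L' ∧ InducesOn L L' B rfl

/-- `m_B`: the maximal `m'` such that `L` induces an `(m' × |B|)`-system on `B`. -/
noncomputable def mMax {m k : ℕ} (L : Matrix (Fin m) (Fin k) F) (B : Finset (Fin k)) : ℕ :=
  sSup {m' | ∃ L' : Matrix (Fin m') (Fin B.card) F, RowsIndep L' ∧ InducesOn L L' B rfl}

/-- `Φ_L(B, f)`. -/
noncomputable def Phi {m k n : ℕ} (L : Matrix (Fin m) (Fin k) F) (B : Finset (Fin k))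
    (f : (Fin n → F) → ℝ) : ℝ :=
  (∑ x ∈ solutions L n, ∏ j ∈ B, f (x j)) / (solutions L n).card

/-- `B` is rank-reducing for `L`: deleting the columns indexed by `B` decreases the rank. -/
def RankReducing {m k : ℕ} (L : Matrix (Fin m) (Fin k) F) (B : Finset (Fin k)) : Prop :=
  (L.submatrix id fun j : {j : Fin k // j ∉ B} => (j : Fin k)).rank < L.rank

end Defs

section Reduction

variable {F : Type} [Field F]

/-- The unnormalised count of the configurations `(u, w, a u + c w, b u + d w)`, weighted by `f`. -/
def quadSum {V : Type} [AddCommGroup V] [Module F V] [Fintype V] (a b c d : F) (f : V → ℝ) : ℝ :=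
  ∑ u, ∑ w, f u * f w * f (a • u + c • w) * f (b • u + d • w)

/-- Some mean-zero function on some finite `F`-vector space has a negative weighted count of the
configurations `(u, w, a u + c w, b u + d w)`. -/
def HasNegativeQuadSum (a b c d : F) : Prop :=
  ∃ (V : Type) (_ : AddCommGroup V) (_ : Module F V) (_ : Fintype V) (f : V → ℝ),
    ∑ x, f x = 0 ∧ quadSum a b c d f < 0

theorem HasNegativeQuadSum.exists_fin {a b c d : F} (h : HasNegativeQuadSum a b c d) [Fintype F] :
    ∃ (n : ℕ) (f : (Fin n → F) → ℝ), 1 ≤ n ∧ ∑ x, f x = 0 ∧ quadSum a b c d f < 0 := by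
  obtain ⟨V, _, _, _, f, h0, hneg⟩ := h
  let e := (Module.finBasis F V).equivFun
  refine ⟨Module.finrank F V, fun x => f (e.symm x), ?_, ?_, ?_⟩
  · by_contra hn
    have hV : Subsingleton V := (Module.finrank_zero_iff (R := F)).mp (by omega)
    have hf : ∀ x, f x = 0 := fun x => by
      have : (Finset.univ : Finset V) = {x} := by
        ext y; simp [Subsingleton.elim y x]
      rw [this, Finset.sum_singleton] at h0
      exact h0
    simp [quadSum, hf] at hneg
  · rw [← h0]
    exact Equiv.sum_comp e.symm.toEquiv f
  · refine lt_of_eq_of_lt ?_ hneg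
    unfold quadSum
    rw [← Equiv.sum_comp e.symm.toEquiv]
    refine Finset.sum_congr rfl fun u _ => ?_
    rw [← Equiv.sum_comp e.symm.toEquiv]
    refine Finset.sum_congr rfl fun w _ => ?_
    simp

theorem sum_comp_smul_add {V : Type} [AddCommGroup V] [Module F V] [Fintype V]
    (f : V → ℝ) {β : F} (hβ : β ≠ 0) (v : V) : ∑ w, f (v + β • w) = ∑ w, f w :=
  Equiv.sum_comp ((LinearEquiv.smulOfNeZero F V β hβ).toEquiv.trans (Equiv.addLeft v)) f

theorem sum_mul_eq_zero_of_det_ne_zero {V : Type} [AddCommGroup V] [Module F V] [Fintype V]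
    {f : V → ℝ} (hf : ∑ x, f x = 0) {α β γ δ : F} (hβ : β ≠ 0) (hdet : α * δ - β * γ ≠ 0) :
    ∑ u, ∑ w, f (α • u + β • w) * f (γ • u + δ • w) = 0 := by
  have key : ∀ u, ∑ w, f (α • u + β • w) * f (γ • u + δ • w) =
      ∑ w, f w * f ((δ * β⁻¹) • w + (γ - δ * β⁻¹ * α) • u) := fun u => by
    rw [← Equiv.sum_comp
      ((LinearEquiv.smulOfNeZero F V β hβ).toEquiv.trans (Equiv.addLeft (α • u)))
      (fun w => f w * f ((δ * β⁻¹) • w + (γ - δ * β⁻¹ * α) • u))]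
    refine Finset.sum_congr rfl fun w _ => ?_
    have : γ • u + δ • w = (δ * β⁻¹) • (α • u + β • w) + (γ - δ * β⁻¹ * α) • u := by
      rw [smul_add, smul_smul, smul_smul, sub_smul, mul_assoc δ β⁻¹ β, inv_mul_cancel₀ hβ, mul_one]
      abel
    rw [this]
    rfl
  have hκ : γ - δ * β⁻¹ * α ≠ 0 := by
    intro h
    apply hdet
    field_simp at h
    linear_combination -h
  simp_rw [key]
  rw [Finset.sum_comm]
  refine Finset.sum_eq_zero fun w _ => ?_
  rw [← Finset.mul_sum, sum_comp_smul_add f hκ, hf, mul_zero]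

variable [DecidableEq F]

theorem minor_ne_zero {L : Matrix (Fin 2) (Fin 4) F} (hL : RowsIndep L) (hs : sMin L = 3)
    {i j : Fin 4} (hij : i ≠ j) : L 0 i * L 1 j - L 0 j * L 1 i ≠ 0 := by
  intro h0
  obtain ⟨α, β, hαβ, hi, hj⟩ : ∃ α β : F, (α ≠ 0 ∨ β ≠ 0) ∧
      α * L 0 i + β * L 1 i = 0 ∧ α * L 0 j + β * L 1 j = 0 := by
    by_cases h1 : L 1 i = 0 ∧ L 0 i = 0
    · by_cases h2 : L 1 j = 0 ∧ L 0 j = 0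
      · exact ⟨1, 0, by simp, by simp [h1], by simp [h2]⟩
      · refine ⟨L 1 j, -L 0 j, ?_, by simp [h1], by ring⟩
        simp only [ne_eq, neg_eq_zero]
        tauto
    · refine ⟨L 1 i, -L 0 i, ?_, by ring, by linear_combination -h0⟩
      simp only [ne_eq, neg_eq_zero]
      tauto
  have hc0 : (fun t => α * L 0 t + β * L 1 t) ≠ 0 := by
    intro hc
    have := Fintype.linearIndependent_iff.mp hL ![α, β] (by
      funext t
      simpa [Fin.sum_univ_two] using congrFun hc t)
    have h0 := this 0
    have h1 := this 1
    simp at h0 h1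
    tauto
  have hind : InducedEq L (fun t => α * L 0 t + β * L 1 t) := by
    intro x hx
    have h0 := hx 0
    have h1 := hx 1
    simp only [Fin.sum_univ_four] at h0 h1 ⊢
    linear_combination α * h0 + β * h1
  have hle : sMin L ≤ eqLength (fun t => α * L 0 t + β * L 1 t) :=
    Nat.sInf_le ⟨_, hc0, hind, rfl⟩
  have hlen : eqLength (fun t => α * L 0 t + β * L 1 t) ≤ 2 := by
    unfold eqLength
    calc _ ≤ (({i, j} : Finset (Fin 4))ᶜ).card := by
            refine Finset.card_le_card fun t ht => ?_
            simp only [Finset.mem_filter, Finset.mem_univ, true_and, Finset.mem_compl,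
              Finset.mem_insert, Finset.mem_singleton] at ht ⊢
            rintro (rfl | rfl)
            · exact ht hi
            · exact ht hj
      _ = 2 := by
            rw [Finset.card_compl, Finset.card_pair hij]
            rfl
  omega

variable [Fintype F]

theorem exists_parametrization {L : Matrix (Fin 2) (Fin 4) F} (hL : RowsIndep L)
    (hs : sMin L = 3) :
    ∃ a b c d : F, a ≠ 0 ∧ b ≠ 0 ∧ c ≠ 0 ∧ d ≠ 0 ∧ a * d - c * b ≠ 0 ∧
      ∀ n (x : Fin 4 → Fin n → F), x ∈ solutions L n ↔
        x 2 = a • x 0 + c • x 1 ∧ x 3 = b • x 0 + d • x 1 := by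
  have m01 := minor_ne_zero hL hs (show (0 : Fin 4) ≠ 1 by decide)
  have m02 := minor_ne_zero hL hs (show (0 : Fin 4) ≠ 2 by decide)
  have m03 := minor_ne_zero hL hs (show (0 : Fin 4) ≠ 3 by decide)
  have m12 := minor_ne_zero hL hs (show (1 : Fin 4) ≠ 2 by decide)
  have m13 := minor_ne_zero hL hs (show (1 : Fin 4) ≠ 3 by decide)
  have m23 := minor_ne_zero hL hs (show (2 : Fin 4) ≠ 3 by decide)
  obtain ⟨e, he⟩ : ∃ e, (L 0 2 * L 1 3 - L 0 3 * L 1 2) * e = 1 := ⟨_, mul_inv_cancel₀ m23⟩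
  have he0 : e ≠ 0 := right_ne_zero_of_mul_eq_one he
  refine ⟨_, _, _, _, mul_ne_zero (neg_ne_zero.mpr m03) he0, mul_ne_zero m02 he0,
    mul_ne_zero (neg_ne_zero.mpr m13) he0, mul_ne_zero m12 he0, ?_, fun n x => ?_⟩
  · intro h
    apply mul_ne_zero m01 m23
    linear_combination (L 0 2 * L 1 3 - L 0 3 * L 1 2) ^ 2 * h
      - (L 0 0 * L 1 1 - L 0 1 * L 1 0) * (L 0 2 * L 1 3 - L 0 3 * L 1 2) *
        ((L 0 2 * L 1 3 - L 0 3 * L 1 2) * e + 1) * he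
  · simp only [solutions, Finset.mem_filter, Finset.mem_univ, true_and, Fin.forall_fin_two,
      Fin.sum_univ_four, funext_iff, Pi.add_apply, Pi.smul_apply, smul_eq_mul, Pi.zero_apply]
    constructor
    · rintro ⟨h0, h1⟩
      exact ⟨fun t => by
          linear_combination e * (L 1 3 * h0 t - L 0 3 * h1 t) - x 2 t * he,
        fun t => by
          linear_combination e * (L 0 2 * h1 t - L 1 2 * h0 t) - x 3 t * he⟩
    · rintro ⟨h2, h3⟩
      refine ⟨fun t => ?_, fun t => ?_⟩
      · rw [h2 t, h3 t]
        linear_combination -(L 0 0 * x 0 t + L 0 1 * x 1 t) * he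
      · rw [h2 t, h3 t]
        linear_combination -(L 1 0 * x 0 t + L 1 1 * x 1 t) * he

theorem sum_solutions {L : Matrix (Fin 2) (Fin 4) F} {a b c d : F} {n : ℕ}
    (hsol : ∀ x : Fin 4 → Fin n → F, x ∈ solutions L n ↔
        x 2 = a • x 0 + c • x 1 ∧ x 3 = b • x 0 + d • x 1) (G : (Fin 4 → Fin n → F) → ℝ) :
    ∑ x ∈ solutions L n, G x = ∑ u, ∑ w, G ![u, w, a • u + c • w, b • u + d • w] := by
  rw [← Fintype.sum_prod_type']
  refine Finset.sum_nbij' (fun x => (x 0, x 1))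
    (fun p => ![p.1, p.2, a • p.1 + c • p.2, b • p.1 + d • p.2]) ?_ ?_ ?_ ?_ ?_
  · simp
  · intro p _
    rw [hsol]
    simp
  · intro x hx
    rw [hsol] at hx
    funext i
    fin_cases i <;> simp [hx]
  · simp
  · intro x hx
    rw [hsol] at hx
    congr 1
    funext i
    fin_cases i <;> simp [hx]

theorem not_isCommon_of_hasNegativeQuadSum {L : Matrix (Fin 2) (Fin 4) F} {a b c d : F}
    (ha : a ≠ 0) (hc : c ≠ 0) (hd : d ≠ 0) (hdet : a * d - c * b ≠ 0) (hb : b ≠ 0)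
    (hsol : ∀ n (x : Fin 4 → Fin n → F), x ∈ solutions L n ↔
        x 2 = a • x 0 + c • x 1 ∧ x 3 = b • x 0 + d • x 1)
    (h : HasNegativeQuadSum a b c d) : ¬ IsCommon L := by
  obtain ⟨n, f, hn, h0, hneg⟩ := h.exists_fin
  intro hcom
  have hC : 0 < 1 + ∑ x, |f x| := by positivity
  set C := 1 + ∑ x, |f x| with hCdef
  let g : (Fin n → F) → ℝ := fun x => f x / (2 * C)
  have hg0 : ∑ x, g x = 0 := by
    simp only [g, ← Finset.sum_div, h0, zero_div]
  have hgneg : quadSum a b c d g < 0 := by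
    have : quadSum a b c d g = quadSum a b c d f / (2 * C) ^ 4 := by
      simp only [quadSum, Finset.sum_div]
      refine Finset.sum_congr rfl fun u _ => Finset.sum_congr rfl fun w _ => ?_
      simp only [g]
      field_simp
    rw [this]
    exact div_neg_of_neg_of_pos hneg (by positivity)
  have hgI : ∀ y, g y ∈ Set.Icc (-(1 / 2) : ℝ) (1 / 2) := fun y => by
    have h1 : |f y| ≤ C := by
      have := Finset.single_le_sum (f := fun x => |f x|) (fun x _ => abs_nonneg (f x))
        (Finset.mem_univ y)
      linarith
    have h2 := abs_le.mp h1
    constructor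
    · rw [le_div_iff₀ (by positivity)]; linarith
    · rw [div_le_iff₀ (by positivity)]; linarith
  have hN : (0 : ℝ) < (solutions L n).card := by
    have : (0 : Fin 4 → Fin n → F) ∈ solutions L n := by simp [solutions]
    exact_mod_cast Finset.card_pos.mpr ⟨_, this⟩
  have hcard : ((solutions L n).card : ℝ) = ∑ _u : Fin n → F, ∑ _w : Fin n → F, (1 : ℝ) := by
    rw [← sum_solutions (hsol n) (fun _ => 1)]
    simp
  have hpair : ∀ {α β γ δ : F}, β ≠ 0 → α * δ - β * γ ≠ 0 →
      ∑ u, ∑ w, g (α • u + β • w) * g (γ • u + δ • w) = 0 :=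
    fun hβ hdet => sum_mul_eq_zero_of_det_ne_zero hg0 hβ hdet
  have p01 := hpair (α := 0) (β := 1) (γ := 1) (δ := 0) (by simp) (by simp)
  have p12 := hpair (α := 0) (β := 1) (γ := a) (δ := c) (by simp) (by simpa using ha)
  have p13 := hpair (α := 0) (β := 1) (γ := b) (δ := d) (by simp) (by simpa using hb)
  have p02 := hpair (α := a) (β := c) (γ := 1) (δ := 0) hc (by simpa using hc)
  have p03 := hpair (α := b) (β := d) (γ := 1) (δ := 0) hd (by simpa using hd)
  have p23 := hpair hc hdet
  simp only [zero_smul, one_smul, zero_add, add_zero] at p01 p12 p13 p02 p03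
  have hdelta : deltaSol L g * (solutions L n).card
      = 1 / 8 * (solutions L n).card + 2 * quadSum a b c d g := by
    unfold deltaSol lambdaSol
    rw [sum_solutions (hsol n), sum_solutions (hsol n), ← add_div, div_mul_cancel₀ _ hN.ne', hcard]
    have expand : ∀ u w : Fin n → F,
        (∏ j, (1 / 2 + g (![u, w, a • u + c • w, b • u + d • w] j))) +
        (∏ j, (1 / 2 - g (![u, w, a • u + c • w, b • u + d • w] j))) =
        1 / 8 * 1 + 2 * (g u * g w * g (a • u + c • w) * g (b • u + d • w)) +
        1 / 2 * (g w * g u) + 1 / 2 * (g w * g (a • u + c • w)) +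
        1 / 2 * (g w * g (b • u + d • w)) + 1 / 2 * (g (a • u + c • w) * g u) +
        1 / 2 * (g (b • u + d • w) * g u) +
        1 / 2 * (g (a • u + c • w) * g (b • u + d • w)) := fun u w => by
      simp only [Fin.prod_univ_four, Matrix.cons_val]
      ring
    simp only [← Finset.sum_add_distrib, expand]
    simp only [Finset.sum_add_distrib, ← Finset.mul_sum, p01, p12, p13, p02, p03, p23, quadSum]
    ring
  have hge := hcom n hn g hgI
  have h8 : (2 : ℝ) ^ (1 - ((4 : ℕ) : ℤ)) = 1 / 8 := by norm_num
  rw [h8] at hge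
  nlinarith

end Reduction

section CharTwo

variable {F : Type} [Field F]

theorem exists_cubic_without_root [Finite F] (h2 : (2 : F) = 0) :
    ∃ β : F, ∀ x y : F, x ^ 3 + x ^ 2 * y + β * y ^ 3 = 0 ↔ x = 0 ∧ y = 0 := by
  have hinj : ¬ Function.Injective (fun t : F => t ^ 3 + t ^ 2) := fun h =>
    zero_ne_one (h (show (0 : F) ^ 3 + 0 ^ 2 = 1 ^ 3 + 1 ^ 2 by linear_combination -h2))
  rw [Finite.injective_iff_surjective] at hinj
  obtain ⟨β, hβ⟩ := not_forall.mp hinj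
  refine ⟨β, fun x y => ⟨fun h => ?_, fun h => by simp [h.1, h.2]⟩⟩
  by_cases hy : y = 0
  · subst hy
    simpa using h
  · refine absurd ⟨x / y, ?_⟩ hβ
    simp only
    field_simp
    linear_combination h - β * y ^ 3 * h2

variable [Fintype F] [DecidableEq F]

theorem hasNegativeQuadSum_of_two_eq_zero (h2 : (2 : F) = 0) {a : F} (ha : a ≠ 0)
    (ha1 : 1 + a ≠ 0) : HasNegativeQuadSum a (1 + a) (1 + a) a := by
  obtain ⟨β, hβ⟩ := exists_cubic_without_root h2
  let χ := AddChar.FiniteField.primitiveChar_to_Complex F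
  have hχ : χ.IsPrimitive := AddChar.FiniteField.primitiveChar_to_Complex_isPrimitive F
  let P : F × F × F → F := fun x => x.1 ^ 3 + x.1 ^ 2 * x.2.1 + β * x.2.1 ^ 3
  let f : F → F × F × F → ℝ := fun c x => (χ (c * P x + x.2.2)).re
  have hreal : ∀ t, ((χ t).re : ℂ) = χ t := fun t => by
    rw [← Complex.conj_eq_iff_re, ← AddChar.map_neg_eq_conj]
    congr 1
    linear_combination -t * h2
  have hf : ∀ c x, (f c x : ℂ) = χ (c * P x + x.2.2) := fun c x => hreal _
  have hmean : ∀ c, ∑ x, f c x = 0 := fun c => by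
    have : ((∑ x, f c x : ℝ) : ℂ) = 0 := by
      push_cast
      simp only [hf, Fintype.sum_prod_type, AddChar.map_add_eq_mul, P, ← Finset.mul_sum]
      have := AddChar.sum_mulShift 1 hχ
      simp only [mul_one, one_ne_zero, if_false, Nat.cast_zero] at this
      simp [this]
    exact_mod_cast this
  have hsum : ∀ c, (quadSum a (1 + a) (1 + a) a (f c) : ℂ) =
      ∑ u, ∑ w, χ (c * ((a * (1 + a)) * P (u + w))) := fun c => by
    unfold quadSum
    push_cast
    refine Finset.sum_congr rfl fun u _ => Finset.sum_congr rfl fun w _ => ?_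
    simp only [hf, ← AddChar.map_add_eq_mul]
    congr 1
    simp only [P, Prod.fst_add, Prod.snd_add, Prod.smul_fst, Prod.smul_snd, smul_eq_mul]
    grind
  have hcount : ∑ c, quadSum a (1 + a) (1 + a) a (f c) = (Fintype.card F : ℝ) ^ 5 := by
    have : ((∑ c, quadSum a (1 + a) (1 + a) a (f c) : ℝ) : ℂ) = (Fintype.card F : ℂ) ^ 5 := by
      push_cast
      simp only [hsum]
      rw [Finset.sum_comm]
      simp_rw [Finset.sum_comm (s := (Finset.univ : Finset F)), AddChar.sum_mulShift _ hχ]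
      have hP : ∀ x : F × F × F, a * (1 + a) * P x = 0 ↔ x.1 = 0 ∧ x.2.1 = 0 := fun x => by
        rw [← hβ]
        simp [ha, ha1, P]
      simp_rw [hP]
      have hshift : ∀ u : F × F × F, ∑ w : F × F × F,
          (((if (u + w).1 = 0 ∧ (u + w).2.1 = 0 then Fintype.card F else 0 : ℕ)) : ℂ) =
          (Fintype.card F : ℂ) ^ 2 := fun u => by
        refine (Equiv.sum_comp (Equiv.addLeft u) (fun w : F × F × F =>
          ((if w.1 = 0 ∧ w.2.1 = 0 then Fintype.card F else 0 : ℕ) : ℂ))).trans ?_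
        simp only [Fintype.sum_prod_type]
        rw [Finset.sum_eq_single 0, Finset.sum_eq_single 0]
        · simp [sq]
        all_goals simp +contextual
      simp only [hshift, Finset.sum_const, Finset.card_univ, Fintype.card_prod, nsmul_eq_mul]
      push_cast
      ring
    exact_mod_cast this
  have hzero : quadSum a (1 + a) (1 + a) a (f 0) = (Fintype.card F : ℝ) ^ 6 := by
    have : (quadSum a (1 + a) (1 + a) a (f 0) : ℂ) = (Fintype.card F : ℂ) ^ 6 := by
      rw [hsum]
      simp
      ring
    exact_mod_cast this
  by_contra hno
  have hnonneg : ∀ c, 0 ≤ quadSum a (1 + a) (1 + a) a (f c) := fun c => by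
    by_contra hc
    exact hno ⟨_, _, _, _, f c, hmean c, not_le.mp hc⟩
  have hle := Finset.single_le_sum (fun c _ => hnonneg c) (Finset.mem_univ 0)
  rw [hcount, hzero] at hle
  have hq : (1 : ℝ) < Fintype.card F := by exact_mod_cast Fintype.one_lt_card
  have := pow_lt_pow_right₀ hq (show 5 < 6 by norm_num)
  linarith

end CharTwo

section CharacterSums

variable {F : Type} [Field F] [Fintype F] [DecidableEq F] {χ : AddChar F ℂ}

theorem sum_char_linear (hχ : χ.IsPrimitive) (p r p' r' : F) :
    ∑ y : F × F, ∑ y' : F × F, χ (y.1 * p + y.2 * r + y'.1 * p' + y'.2 * r') =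
      ((if p = 0 ∧ r = 0 ∧ p' = 0 ∧ r' = 0 then Fintype.card F ^ 4 else 0 : ℕ) : ℂ) := by
  have h := fun b => AddChar.sum_mulShift b hχ
  simp only [AddChar.map_add_eq_mul, Fintype.sum_prod_type, ← Finset.mul_sum, ← Finset.sum_mul, h]
  by_cases hp : p = 0 <;> by_cases hr : r = 0 <;> by_cases hp' : p' = 0 <;>
    by_cases hr' : r' = 0 <;> simp [hp, hr, hp', hr']
  ring

theorem sum_ite_linear_eq_zero {p r : F} (h : p ≠ 0 ∨ r ≠ 0) (q : ℕ) :
    ∑ s : F, ∑ t : F, (if s * p + t * r = 0 then q else 0) = Fintype.card F * q := by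
  have key : ∀ {p r : F}, r ≠ 0 →
      ∑ s : F, ∑ t : F, (if s * p + t * r = 0 then q else 0) = Fintype.card F * q := by
    intro p r hr
    have : ∀ s t : F, s * p + t * r = 0 ↔ t = -(s * p) / r := fun s t => by
      rw [eq_div_iff hr]
      exact ⟨fun h => by linear_combination h, fun h => by linear_combination h⟩
    simp [this]
  rcases h with hp | hr
  · rw [Finset.sum_comm]
    simp_rw [add_comm]
    exact key hp
  · exact key hr

theorem exists_sum_char_symm_form (hχ : χ.IsPrimitive) (A B C : F) :
    ∃ N : ℕ, ∑ z : F × F, ∑ z' : F × F,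
        χ (z.1 * (z.2 * A + z'.2 * B) + z'.1 * (z.2 * B + z'.2 * C)) = N ∧
      N ≤ Fintype.card F ^ 4 ∧
      (A = 0 ∧ B = 0 ∧ C = 0 → N = Fintype.card F ^ 4) ∧
      (¬ (A = 0 ∧ B = 0 ∧ C = 0) → 2 * N ≤ Fintype.card F ^ 4) := by
  have h := fun b => AddChar.sum_mulShift b hχ
  set q := Fintype.card F with hq
  refine ⟨∑ s : F, ∑ t : F, (if s * A + t * B = 0 then q else 0) *
    (if s * B + t * C = 0 then q else 0), ?_, ?_, ?_, ?_⟩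
  · push_cast
    simp only [Fintype.sum_prod_type]
    rw [Finset.sum_comm]
    refine Finset.sum_congr rfl fun s _ => ?_
    calc _ = ∑ x : F, ∑ t : F, ∑ y : F, χ (x * (s * A + t * B)) * χ (y * (s * B + t * C)) := by
          refine Finset.sum_congr rfl fun x _ => ?_
          rw [Finset.sum_comm]
          simp only [AddChar.map_add_eq_mul]
      _ = _ := by
          rw [Finset.sum_comm]
          refine Finset.sum_congr rfl fun t _ => ?_
          simp only [← Finset.mul_sum, ← Finset.sum_mul, h, Nat.cast_ite, Nat.cast_zero, hq]
  · calc _ ≤ ∑ s : F, ∑ t : F, q * q := by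
          refine Finset.sum_le_sum fun s _ => Finset.sum_le_sum fun t _ => ?_
          gcongr <;> split_ifs <;> simp
      _ = q ^ 4 := by
          simp only [Finset.sum_const, Finset.card_univ, smul_eq_mul, ← hq]
          ring
  · rintro ⟨rfl, rfl, rfl⟩
    simp only [mul_zero, add_zero, if_true, Finset.sum_const, Finset.card_univ, smul_eq_mul, ← hq]
    ring
  · intro hM
    have hq2 : 2 ≤ q := Fintype.one_lt_card
    suffices hle : ∑ s : F, ∑ t : F, (if s * A + t * B = 0 then q else 0) *
        (if s * B + t * C = 0 then q else 0) ≤ q * q * q by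
      calc _ ≤ q * (q * q * q) := Nat.mul_le_mul hq2 hle
        _ = q ^ 4 := by ring
    by_cases hAB : A ≠ 0 ∨ B ≠ 0
    · rw [mul_assoc q q q, ← sum_ite_linear_eq_zero hAB]
      refine Finset.sum_le_sum fun s _ => Finset.sum_le_sum fun t _ => ?_
      split_ifs <;> simp
    · have hBC : B ≠ 0 ∨ C ≠ 0 := by tauto
      rw [mul_assoc q q q, ← sum_ite_linear_eq_zero hBC]
      refine Finset.sum_le_sum fun s _ => Finset.sum_le_sum fun t _ => ?_
      split_ifs <;> simp

end CharacterSums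

section SignAverage

/-- The coefficient of the monomial `e i₀ e i₁ e i₂ e i₃` in the average over signs `e` with
`∏ k, e k = -1`, up to normalisation. -/
def signWeight (i₀ i₁ i₂ i₃ : Fin 4) : ℤ :=
  ∑ e : Fin 4 → ℤˣ, (1 - ∏ k, (e k : ℤ)) * (e i₀ * e i₁ * e i₂ * e i₃)

theorem eq_of_signWeight_pos : ∀ i₀ i₁ i₂ i₃ : Fin 4, 0 < signWeight i₀ i₁ i₂ i₃ →
    (i₀ = i₁ ∧ i₂ = i₃) ∨ (i₀ = i₂ ∧ i₁ = i₃) ∨ (i₀ = i₃ ∧ i₁ = i₂) := by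
  decide +kernel

theorem signWeight_le : ∀ i₀ i₁ i₂ i₃ : Fin 4, signWeight i₀ i₁ i₂ i₃ ≤ 16 := by
  decide +kernel

theorem signWeight_id : signWeight 0 1 2 3 = -16 := by
  decide +kernel

end SignAverage

section QuadraticPhases

variable {F : Type} [Field F]

/-- The columns of a `2 × 4` matrix annihilating all `(u, w, a u + c w, b u + d w)`. -/
def linearFreq (a b c d : F) : Fin 4 → F × F := ![(a, b), (c, d), (-1, 0), (0, -1)]

/-- The coefficients of the diagonal quadratic form vanishing on all
`(u, w, a u + c w, b u + d w)`. -/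
def quadraticFreq (a b c d : F) : Fin 4 → F :=
  ![-(a * b * (a * d - c * b)), c * d * (a * d - c * b), b * d, -(a * c)]

/-- The exponents of the quadratic phase functions on `F² × (F²)ᵐ`. -/
def phase (a b c d : F) (m : ℕ) (i : Fin 4) (x : (F × F) × (Fin m → F × F)) : F :=
  x.1.1 * (linearFreq a b c d i).1 + x.1.2 * (linearFreq a b c d i).2 +
    ∑ k, (x.2 k).1 * (x.2 k).2 * quadraticFreq a b c d i

theorem linearFreq_independent {a b c d : F} (ha : a ≠ 0) (hb : b ≠ 0) (hc : c ≠ 0) (hd : d ≠ 0)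
    (hdet : a * d - c * b ≠ 0) {i j : Fin 4} (hij : i ≠ j) {x y : F}
    (h1 : x * (linearFreq a b c d i).1 + y * (linearFreq a b c d j).1 = 0)
    (h2 : x * (linearFreq a b c d i).2 + y * (linearFreq a b c d j).2 = 0) : x = 0 ∧ y = 0 := by
  have hD : (linearFreq a b c d i).1 * (linearFreq a b c d j).2 -
      (linearFreq a b c d j).1 * (linearFreq a b c d i).2 ≠ 0 := by
    have hdet' : c * b - a * d ≠ 0 := fun h => hdet (by linear_combination -h)
    fin_cases i <;> fin_cases j <;> first | exact absurd rfl hij | skip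
    all_goals simp [linearFreq, ha, hb, hc, hd, hdet, hdet']
  constructor
  · refine (mul_eq_zero.mp ?_).resolve_right hD
    linear_combination (linearFreq a b c d j).2 * h1 - (linearFreq a b c d j).1 * h2
  · refine (mul_eq_zero.mp ?_).resolve_right hD
    linear_combination (linearFreq a b c d i).1 * h2 - (linearFreq a b c d i).2 * h1

theorem linearFreq_ne_zero {a b c d : F} (ha : a ≠ 0) (hc : c ≠ 0) (i : Fin 4) :
    (linearFreq a b c d i).1 ≠ 0 ∨ (linearFreq a b c d i).2 ≠ 0 := by
  fin_cases i <;> simp [linearFreq, ha, hc]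

theorem quadraticFreq_ne_zero {a b c d : F} (ha : a ≠ 0) (hb : b ≠ 0) (hc : c ≠ 0) (hd : d ≠ 0)
    (hdet : a * d - c * b ≠ 0) (i : Fin 4) : quadraticFreq a b c d i ≠ 0 := by
  fin_cases i <;> simp [quadraticFreq, ha, hb, hc, hd, hdet]

/-- A sign vector `s` obstructs the quadratic phases if both `∑ s_j x_j` and `∑ s_j x_j²` vanish
identically on the space of all `(u, w, a u + c w, b u + d w)`. -/
def SignObstruction (a b c d : F) (s : Fin 4 → ℤˣ) : Prop :=
  (s 0 : F) + a * (s 2 : F) + b * (s 3 : F) = 0 ∧ (s 1 : F) + c * (s 2 : F) + d * (s 3 : F) = 0 ∧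
  (s 0 : F) + a ^ 2 * (s 2 : F) + b ^ 2 * (s 3 : F) = 0 ∧
  a * c * (s 2 : F) + b * d * (s 3 : F) = 0 ∧
  (s 1 : F) + c ^ 2 * (s 2 : F) + d ^ 2 * (s 3 : F) = 0

end QuadraticPhases

section PatternSums

theorem map_sum_eq_prod {F ι : Type} [Field F] (χ : AddChar F ℂ) (S : Finset ι) (g : ι → F) :
    χ (∑ k ∈ S, g k) = ∏ k ∈ S, χ (g k) :=
  map_prod χ.toMonoidHom (fun k => Multiplicative.ofAdd (g k)) S

variable {F : Type} [Field F] [Fintype F] [DecidableEq F] {χ : AddChar F ℂ}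

theorem sum_sum_prod_eq_pow {Z : Type} [Fintype Z] [DecidableEq Z] (m : ℕ) (g : Z → Z → ℂ) :
    ∑ z : Fin m → Z, ∑ z' : Fin m → Z, ∏ k, g (z k) (z' k) = (∑ z, ∑ z', g z z') ^ m := by
  rw [← Fintype.sum_prod_type', ← Fintype.sum_prod_type', Fintype.sum_pow,
    ← Equiv.sum_comp (Equiv.arrowProdEquivProdArrow (Fin m) (fun _ => Z) (fun _ => Z))]
  rfl

/-- The character sum attached to a choice of phase functions `i j` and signs `s j` in the four
positions of the configuration `(u, w, a u + c w, b u + d w)`. -/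
noncomputable def patternSum (χ : AddChar F ℂ) (a b c d : F) (m : ℕ) (i : Fin 4 → Fin 4)
    (s : Fin 4 → ℤˣ) : ℂ :=
  ∑ u, ∑ w, χ ((s 0 : F) * phase a b c d m (i 0) u) * χ ((s 1 : F) * phase a b c d m (i 1) w) *
    χ ((s 2 : F) * phase a b c d m (i 2) (a • u + c • w)) *
    χ ((s 3 : F) * phase a b c d m (i 3) (b • u + d • w))

theorem patternSum_eq (χ : AddChar F ℂ) (a b c d : F) (m : ℕ) (i : Fin 4 → Fin 4)
    (s : Fin 4 → ℤˣ) {n : Fin 4 → F × F} (hn : ∀ j, n j = (s j : F) • linearFreq a b c d (i j))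
    {μ : Fin 4 → F} (hμ : ∀ j, μ j = (s j : F) * quadraticFreq a b c d (i j)) :
    patternSum χ a b c d m i s =
      (∑ y : F × F, ∑ y' : F × F, χ (y.1 * ((n 0).1 + a * (n 2).1 + b * (n 3).1) +
        y.2 * ((n 0).2 + a * (n 2).2 + b * (n 3).2) +
        y'.1 * ((n 1).1 + c * (n 2).1 + d * (n 3).1) +
        y'.2 * ((n 1).2 + c * (n 2).2 + d * (n 3).2))) *
      (∑ z : F × F, ∑ z' : F × F, χ (z.1 * (z.2 * (μ 0 + a ^ 2 * μ 2 + b ^ 2 * μ 3) +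
        z'.2 * (a * c * μ 2 + b * d * μ 3)) + z'.1 * (z.2 * (a * c * μ 2 + b * d * μ 3) +
        z'.2 * (μ 1 + c ^ 2 * μ 2 + d ^ 2 * μ 3)))) ^ m := by
  rw [← sum_sum_prod_eq_pow]
  unfold patternSum
  rw [Fintype.sum_prod_type, Finset.sum_mul]
  refine Finset.sum_congr rfl fun y _ => ?_
  simp_rw [Fintype.sum_prod_type (α₁ := F × F) (α₂ := Fin m → F × F)]
  rw [Finset.sum_comm, Finset.sum_mul]
  refine Finset.sum_congr rfl fun y' _ => ?_
  rw [Finset.mul_sum]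
  refine Finset.sum_congr rfl fun z _ => ?_
  rw [Finset.mul_sum]
  refine Finset.sum_congr rfl fun z' _ => ?_
  rw [← map_sum_eq_prod]
  simp only [← AddChar.map_add_eq_mul]
  congr 1
  have hsum : ∑ k, ((z k).1 * ((z k).2 * (μ 0 + a ^ 2 * μ 2 + b ^ 2 * μ 3) +
        (z' k).2 * (a * c * μ 2 + b * d * μ 3)) + (z' k).1 * ((z k).2 * (a * c * μ 2 + b * d * μ 3) +
        (z' k).2 * (μ 1 + c ^ 2 * μ 2 + d ^ 2 * μ 3))) =
      (s 0 : F) * ∑ k, (z k).1 * (z k).2 * quadraticFreq a b c d (i 0) +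
      (s 1 : F) * ∑ k, (z' k).1 * (z' k).2 * quadraticFreq a b c d (i 1) +
      (s 2 : F) * ∑ k, (a * (z k).1 + c * (z' k).1) * (a * (z k).2 + c * (z' k).2) *
        quadraticFreq a b c d (i 2) +
      (s 3 : F) * ∑ k, (b * (z k).1 + d * (z' k).1) * (b * (z k).2 + d * (z' k).2) *
        quadraticFreq a b c d (i 3) := by
    simp only [Finset.mul_sum, ← Finset.sum_add_distrib, hμ]
    exact Finset.sum_congr rfl fun k _ => by ring
  rw [hsum]
  simp only [phase, hn, Prod.fst_add, Prod.snd_add, Prod.smul_fst, Prod.smul_snd,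
    smul_eq_mul, Pi.add_apply, Pi.smul_apply]
  ring

theorem exists_patternSum (hχ : χ.IsPrimitive) {a b c d : F} (ha : a ≠ 0) (hb : b ≠ 0)
    (hc : c ≠ 0) (hd : d ≠ 0) (hdet : a * d - c * b ≠ 0)
    (hobs : ∀ s, ¬ SignObstruction a b c d s) (m : ℕ) (i : Fin 4 → Fin 4) (s : Fin 4 → ℤˣ) :
    ∃ N : ℕ, patternSum χ a b c d m i s = N ∧
      (0 < signWeight (i 0) (i 1) (i 2) (i 3) → 2 ^ m * N ≤ Fintype.card F ^ (4 + 4 * m)) ∧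
      (i = id → s = 1 → N = Fintype.card F ^ (4 + 4 * m)) := by
  set n : Fin 4 → F × F := fun j => (s j : F) • linearFreq a b c d (i j) with hn
  set μ : Fin 4 → F := fun j => (s j : F) * quadraticFreq a b c d (i j) with hμ
  rw [patternSum_eq χ a b c d m i s (n := n) (fun _ => rfl) (μ := μ) (fun _ => rfl),
    sum_char_linear hχ]
  obtain ⟨K, hK, -, hK0, hK2⟩ := exists_sum_char_symm_form hχ
    (μ 0 + a ^ 2 * μ 2 + b ^ 2 * μ 3) (a * c * μ 2 + b * d * μ 3)
    (μ 1 + c ^ 2 * μ 2 + d ^ 2 * μ 3)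
  rw [hK, ← Nat.cast_pow K, ← Nat.cast_mul]
  refine ⟨_, rfl, fun hpos => ?_, ?_⟩
  · split_ifs with hlin
    · obtain ⟨h1, h2, h3, h4⟩ := hlin
      have hs : ∀ j, (s j : F) ≠ 0 := fun j => by
        rcases Int.units_eq_one_or (s j) with h | h <;> simp [h]
      have hquad : ¬ (μ 0 + a ^ 2 * μ 2 + b ^ 2 * μ 3 = 0 ∧ a * c * μ 2 + b * d * μ 3 = 0 ∧
          μ 1 + c ^ 2 * μ 2 + d ^ 2 * μ 3 = 0) := by
        rintro ⟨hA, hB, hC⟩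
        simp only [hn, hμ, Prod.smul_fst, Prod.smul_snd, smul_eq_mul] at h1 h2 h3 h4 hA hB hC
        by_cases hall : i 0 = i 1 ∧ i 0 = i 2 ∧ i 0 = i 3
        · obtain ⟨e1, e2, e3⟩ := hall
          simp only [← e1, ← e2, ← e3] at h1 h2 h3 h4 hA hB hC
          have hq := quadraticFreq_ne_zero ha hb hc hd hdet (i 0)
          have hlin : (s 0 : F) + a * s 2 + b * s 3 = 0 ∧ (s 1 : F) + c * s 2 + d * s 3 = 0 := by
            rcases linearFreq_ne_zero (b := b) (d := d) ha hc (i 0) with hv | hv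
            · exact ⟨(mul_eq_zero.mp (by linear_combination h1)).resolve_right hv,
                (mul_eq_zero.mp (by linear_combination h3)).resolve_right hv⟩
            · exact ⟨(mul_eq_zero.mp (by linear_combination h2)).resolve_right hv,
                (mul_eq_zero.mp (by linear_combination h4)).resolve_right hv⟩
          exact hobs s ⟨hlin.1, hlin.2,
            (mul_eq_zero.mp (by linear_combination hA)).resolve_right hq,
            (mul_eq_zero.mp (by linear_combination hB)).resolve_right hq,
            (mul_eq_zero.mp (by linear_combination hC)).resolve_right hq⟩
        · have hind := @linearFreq_independent F _ a b c d ha hb hc hd hdet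
          rcases eq_of_signWeight_pos _ _ _ _ hpos with ⟨e, e'⟩ | ⟨e, e'⟩ | ⟨e, e'⟩ <;>
            simp only [← e, ← e'] at h1 h2
          · exact hs 0 (hind (i := i 0) (j := i 2) (fun h => hall ⟨e, h, h.trans e'⟩)
              (x := s 0) (y := a * s 2 + b * s 3)
              (by linear_combination h1) (by linear_combination h2)).1
          · exact mul_ne_zero hb (hs 3) (hind (i := i 0) (j := i 1) (fun h => hall ⟨h, e, h.trans e'⟩)
              (x := s 0 + a * s 2) (y := b * s 3)
              (by linear_combination h1) (by linear_combination h2)).2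
          · exact mul_ne_zero ha (hs 2) (hind (i := i 0) (j := i 1) (fun h => hall ⟨h, h.trans e', e⟩)
              (x := s 0 + b * s 3) (y := a * s 2)
              (by linear_combination h1) (by linear_combination h2)).2
      calc _ = Fintype.card F ^ 4 * (2 * K) ^ m := by ring
        _ ≤ Fintype.card F ^ 4 * (Fintype.card F ^ 4) ^ m := by
          gcongr
          exact hK2 hquad
        _ = _ := by ring
    · simp
  · rintro rfl rfl
    have h1 : ∀ j, n j = linearFreq a b c d j := fun j => by simp [hn]
    have h2 : ∀ j, μ j = quadraticFreq a b c d j := fun j => by simp [hμ]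
    rw [hK0, if_pos]
    · ring
    · simp [h1, linearFreq]
    · simp only [h2, quadraticFreq]
      simp
      refine ⟨?_, ?_, ?_⟩ <;> ring

end PatternSums

section SignedPhases

variable {F : Type} [Field F] [Fintype F] {χ : AddChar F ℂ}

/-- The real part of a signed combination of the quadratic phase functions. -/
noncomputable def signedPhase (χ : AddChar F ℂ) (a b c d : F) (m : ℕ) (e : Fin 4 → ℤˣ)
    (x : (F × F) × (Fin m → F × F)) : ℝ :=
  ∑ i, (e i : ℤ) * (2 * (χ (phase a b c d m i x)).re)

theorem ofReal_signedPhase (χ : AddChar F ℂ) (a b c d : F) (m : ℕ) (e : Fin 4 → ℤˣ)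
    (x : (F × F) × (Fin m → F × F)) : (signedPhase χ a b c d m e x : ℂ) =
      ∑ p : Fin 4 × ℤˣ, ((e p.1 : ℤ) : ℂ) * χ ((p.2 : F) * phase a b c d m p.1 x) := by
  unfold signedPhase
  push_cast
  rw [Fintype.sum_prod_type]
  refine Finset.sum_congr rfl fun i _ => ?_
  rw [UnitsInt.univ, Finset.sum_pair (by decide)]
  simp only [Units.val_one, Units.val_neg, Int.cast_one, Int.cast_neg, one_mul, neg_mul,
    AddChar.map_neg_eq_conj, ← mul_add, Complex.add_conj]
  push_cast
  rfl

theorem quadSum_signedPhase (χ : AddChar F ℂ) (a b c d : F) (m : ℕ) (e : Fin 4 → ℤˣ) :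
    (quadSum a b c d (signedPhase χ a b c d m e) : ℂ) =
      ∑ π : Fin 4 → Fin 4 × ℤˣ,
        ((e (π 0).1 * e (π 1).1 * e (π 2).1 * e (π 3).1 : ℤ) : ℂ) *
          patternSum χ a b c d m (fun j => (π j).1) (fun j => (π j).2) := by
  have hexp : ∀ x₀ x₁ x₂ x₃, (signedPhase χ a b c d m e x₀ : ℂ) * signedPhase χ a b c d m e x₁ *
      signedPhase χ a b c d m e x₂ * signedPhase χ a b c d m e x₃ =
      ∑ π : Fin 4 → Fin 4 × ℤˣ, ((e (π 0).1 * e (π 1).1 * e (π 2).1 * e (π 3).1 : ℤ) : ℂ) *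
        (χ (((π 0).2 : F) * phase a b c d m (π 0).1 x₀) *
          χ (((π 1).2 : F) * phase a b c d m (π 1).1 x₁) *
          χ (((π 2).2 : F) * phase a b c d m (π 2).1 x₂) *
          χ (((π 3).2 : F) * phase a b c d m (π 3).1 x₃)) := fun x₀ x₁ x₂ x₃ => by
    have := Finset.prod_univ_sum (fun _ : Fin 4 => (Finset.univ : Finset (Fin 4 × ℤˣ)))
      (fun j p => ((e p.1 : ℤ) : ℂ) * χ ((p.2 : F) * phase a b c d m p.1 (![x₀, x₁, x₂, x₃] j)))
    rw [Fintype.piFinset_univ, Fin.prod_univ_four] at this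
    simp only [ofReal_signedPhase]
    refine this.trans (Finset.sum_congr rfl fun π _ => ?_)
    rw [Fin.prod_univ_four]
    push_cast
    ring
  simp only [quadSum, patternSum, Complex.ofReal_sum, Complex.ofReal_mul, hexp, Finset.mul_sum]
  exact (Finset.sum_congr rfl fun u _ => Finset.sum_comm).trans Finset.sum_comm

variable [DecidableEq F]

theorem sum_char_phase (hχ : χ.IsPrimitive) {a b c d : F} (ha : a ≠ 0) (hc : c ≠ 0) (m : ℕ)
    {s : F} (hs : s ≠ 0) (i : Fin 4) :
    ∑ x : (F × F) × (Fin m → F × F), χ (s * phase a b c d m i x) = 0 := by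
  have h := fun b => AddChar.sum_mulShift b hχ
  simp only [phase, mul_add, AddChar.map_add_eq_mul, Fintype.sum_prod_type (α₁ := F × F),
    ← Finset.mul_sum, ← Finset.sum_mul]
  refine mul_eq_zero_of_left ?_ _
  simp only [Fintype.sum_prod_type, ← Finset.mul_sum, ← Finset.sum_mul]
  simp only [mul_left_comm s, h, mul_eq_zero, hs, false_or]
  rcases linearFreq_ne_zero (b := b) (d := d) ha hc i with h | h <;> simp [h]

theorem sum_signedPhase (hχ : χ.IsPrimitive) {a b c d : F} (ha : a ≠ 0) (hc : c ≠ 0) (m : ℕ)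
    (e : Fin 4 → ℤˣ) : ∑ x, signedPhase χ a b c d m e x = 0 := by
  have : ((∑ x, signedPhase χ a b c d m e x : ℝ) : ℂ) = 0 := by
    push_cast
    simp only [ofReal_signedPhase]
    rw [Finset.sum_comm]
    refine Finset.sum_eq_zero fun p _ => ?_
    have hp : (p.2 : F) ≠ 0 := by
      rcases Int.units_eq_one_or p.2 with h | h <;> simp [h]
    rw [← Finset.mul_sum, sum_char_phase hχ ha hc m hp, mul_zero]
  exact_mod_cast this

theorem hasNegativeQuadSum_of_forall_not_signObstruction {a b c d : F} (ha : a ≠ 0) (hb : b ≠ 0)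
    (hc : c ≠ 0) (hd : d ≠ 0) (hdet : a * d - c * b ≠ 0)
    (hobs : ∀ s, ¬ SignObstruction a b c d s) : HasNegativeQuadSum a b c d := by
  let χ := AddChar.FiniteField.primitiveChar_to_Complex F
  have hχ : χ.IsPrimitive := AddChar.FiniteField.primitiveChar_to_Complex_isPrimitive F
  let m := 13
  choose N hN hNpos hNid using fun π : Fin 4 → Fin 4 × ℤˣ =>
    exists_patternSum hχ ha hb hc hd hdet hobs m (fun j => (π j).1) (fun j => (π j).2)
  let W : (Fin 4 → Fin 4 × ℤˣ) → ℤ := fun π => signWeight (π 0).1 (π 1).1 (π 2).1 (π 3).1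
  have hsum : ∑ e : Fin 4 → ℤˣ, ((1 - ∏ k, (e k : ℤ) : ℤ) : ℝ) *
      quadSum a b c d (signedPhase χ a b c d m e) = ((∑ π, W π * (N π : ℤ) : ℤ) : ℝ) := by
    have : ((∑ e : Fin 4 → ℤˣ, ((1 - ∏ k, (e k : ℤ) : ℤ) : ℝ) *
        quadSum a b c d (signedPhase χ a b c d m e) : ℝ) : ℂ) =
          ((∑ π, W π * (N π : ℤ) : ℤ) : ℂ) := by
      simp only [Complex.ofReal_sum, Complex.ofReal_mul, Complex.ofReal_intCast,
        quadSum_signedPhase, hN, Finset.mul_sum, ← mul_assoc, ← Int.cast_mul]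
      rw [Finset.sum_comm, Int.cast_sum]
      refine Finset.sum_congr rfl fun π _ => ?_
      rw [← Finset.sum_mul, ← Int.cast_sum, Int.cast_mul, Int.cast_natCast]
      simp only [W, signWeight, mul_assoc]
    exact_mod_cast this
  have hneg : ∑ π, W π * (N π : ℤ) < 0 := by
    set Q : ℕ := Fintype.card F ^ (4 + 4 * m)
    have hQ : 0 < Q := pow_pos Fintype.card_pos _
    let π₀ : Fin 4 → Fin 4 × ℤˣ := fun j => (j, 1)
    have h₀ : W π₀ * (N π₀ : ℤ) = -16 * Q := by
      rw [hNid π₀ rfl rfl, ← signWeight_id]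
    have hle : ∀ π, 2 ^ m * (W π * (N π : ℤ)) ≤ 16 * Q := fun π => by
      rcases le_or_gt (W π) 0 with h | h
      · have : W π * (N π : ℤ) ≤ 0 := mul_nonpos_of_nonpos_of_nonneg h (by positivity)
        have : 2 ^ m * (W π * (N π : ℤ)) ≤ 0 :=
          mul_nonpos_of_nonneg_of_nonpos (by positivity) this
        exact this.trans (by positivity)
      · have h1 : (2 ^ m * N π : ℤ) ≤ Q := by exact_mod_cast hNpos π h
        calc 2 ^ m * (W π * (N π : ℤ)) = W π * (2 ^ m * N π) := by ring
          _ ≤ 16 * Q := mul_le_mul (signWeight_le _ _ _ _) h1 (by positivity) (by norm_num)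
    have hrest : 2 ^ m * ∑ π ∈ Finset.univ.erase π₀, W π * (N π : ℤ) ≤ 4095 * (16 * Q) := by
      rw [Finset.mul_sum]
      refine (Finset.sum_le_card_nsmul _ _ _ fun π _ => hle π).trans (le_of_eq ?_)
      rw [Finset.card_erase_of_mem (Finset.mem_univ _), Finset.card_univ, Fintype.card_fun,
        Fintype.card_prod, Fintype.card_fin, Fintype.card_units_int]
      norm_num
    rw [← Finset.add_sum_erase _ _ (Finset.mem_univ π₀), h₀]
    have hm : (2 : ℤ) ^ m = 8192 := by norm_num [m]
    rw [hm] at hrest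
    lia
  obtain ⟨e, -, he⟩ := Finset.exists_lt_of_sum_lt
    (f := fun e : Fin 4 → ℤˣ => ((1 - ∏ k, (e k : ℤ) : ℤ) : ℝ) *
      quadSum a b c d (signedPhase χ a b c d m e)) (g := fun _ => 0) (s := Finset.univ)
    (by rw [hsum, Finset.sum_const_zero]; exact_mod_cast hneg)
  refine ⟨_, inferInstance, inferInstance, inferInstance, signedPhase χ a b c d m e,
    sum_signedPhase hχ ha hc m e, ?_⟩
  have hw : (0 : ℝ) ≤ ((1 - ∏ k, (e k : ℤ) : ℤ) : ℝ) := by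
    rw [← Units.coe_prod]
    rcases Int.units_eq_one_or (∏ k, e k) with h | h <;> simp [h]
  exact neg_of_mul_neg_right he hw

end SignedPhases

section ObstructionAnalysis

variable {F : Type} [Field F]

theorem eq_of_signed_linear_quadratic {a b : F} (htwo : (2 : F) ≠ 0) (ha : a ≠ 0) (hb : b ≠ 0)
    {s t r : ℤˣ} (h1 : (s : F) + a * (t : F) + b * (r : F) = 0)
    (h2 : (s : F) + a ^ 2 * (t : F) + b ^ 2 * (r : F) = 0) :
    s = t ∧ r = t ∧ 1 + a + b = 0 ∧ 1 + a + a ^ 2 = 0 := by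
  have key : ∀ {x : F}, 2 * x = 0 → x = 0 := fun h => (mul_eq_zero.mp h).resolve_left htwo
  have of_one : a = 1 → (s : F) + t = 0 → (r : F) ^ 2 = 1 → False := by
    rintro rfl hst hr
    exact hb (by linear_combination (r : F) * h1 - (r : F) * hst - b * hr)
  have hr : (r : F) ^ 2 = 1 := by
    rcases Int.units_eq_one_or r with rfl | rfl <;> simp
  have hmul : (s : F) * r + a ^ 2 * t * r + (s + a * t) ^ 2 = 0 := by
    linear_combination (r : F) * h2 + (s + a * t - b * r) * h1
  rcases Int.units_eq_one_or s with rfl | rfl <;> rcases Int.units_eq_one_or t with rfl | rfl <;>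
    rcases Int.units_eq_one_or r with rfl | rfl <;>
    simp only [Units.val_one, Units.val_neg, Int.cast_one, Int.cast_neg] at h1 hmul of_one hr
  · exact ⟨rfl, rfl, by linear_combination h1, key (by linear_combination hmul)⟩
  · exact absurd (key (by linear_combination hmul)) ha
  · exact (of_one (sub_eq_zero.mp (key (by linear_combination -hmul))) (by ring) hr).elim
  · exact (of_one (sub_eq_zero.mp ((mul_eq_zero.mp (key (x := a * (a - 1))
      (by linear_combination hmul))).resolve_left ha)) (by ring) hr).elim
  · exact (of_one (sub_eq_zero.mp ((mul_eq_zero.mp (key (x := a * (a - 1))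
      (by linear_combination hmul))).resolve_left ha)) (by ring) hr).elim
  · exact (of_one (sub_eq_zero.mp (key (by linear_combination -hmul))) (by ring) hr).elim
  · exact absurd (key (by linear_combination hmul)) ha
  · exact ⟨rfl, rfl, by linear_combination -h1, key (by linear_combination hmul)⟩

theorem two_eq_zero_of_signObstruction {a b c d : F} (ha : a ≠ 0) (hb : b ≠ 0) (hc : c ≠ 0)
    (hd : d ≠ 0) (hdet : a * d - c * b ≠ 0) {s : Fin 4 → ℤˣ} (h : SignObstruction a b c d s) :
    (2 : F) = 0 := by
  obtain ⟨h1, h2, h3, h4, h5⟩ := h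
  by_contra htwo
  obtain ⟨-, e3, hab, ha2⟩ := eq_of_signed_linear_quadratic htwo ha hb h1 h3
  obtain ⟨-, -, hcd, hc2⟩ := eq_of_signed_linear_quadratic htwo hc hd h2 h5
  have hs : (s 2 : F) ≠ 0 := by
    rcases Int.units_eq_one_or (s 2) with h | h <;> simp [h]
  have h4' : a * c + b * d = 0 := by
    rw [e3, ← add_mul] at h4
    exact (mul_eq_zero.mp h4).resolve_right hs
  have hroots : (a - c) * (a + c + 1) = 0 := by linear_combination ha2 - hc2
  rcases mul_eq_zero.mp hroots with hac | hac
  · exact hdet (by linear_combination a * hcd - c * hab - hac)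
  · have : 2 * (a * c) = 0 := by linear_combination h4' - d * hab + (1 + a) * hcd - hac
    simp [htwo, ha, hc] at this

theorem eq_one_add_of_signObstruction {a b c d : F} (h2 : (2 : F) = 0) {s : Fin 4 → ℤˣ}
    (h : SignObstruction a b c d s) : b = 1 + a ∧ c = 1 + a ∧ d = a := by
  have hs : ∀ j, (s j : F) = 1 := fun j => by
    rcases Int.units_eq_one_or (s j) with h | h <;> simp [h]
    linear_combination -h2
  obtain ⟨h1, h3, -, h4, -⟩ := h
  simp only [hs] at h1 h3 h4
  have hc : c = 1 + a := by
    linear_combination h4 + (1 + a) * h3 - d * h1 + (-(1 + a) - a * c) * h2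
  refine ⟨?_, hc, ?_⟩
  · linear_combination h1 - (1 + a) * h2
  · linear_combination h3 - hc - (1 + a) * h2

end ObstructionAnalysis

/-- every `(2 × 4)`-system with `s(L) = 3` is uncommon. -/
theorem uncommon_of_two_by_four_sMin_three
    {F : Type} [Field F] [Fintype F] [DecidableEq F]
    (L : Matrix (Fin 2) (Fin 4) F) (hL : RowsIndep L) (hs : sMin L = 3) :
    ¬ IsCommon L := by
  obtain ⟨a, b, c, d, ha, hb, hc, hd, hdet, hsol⟩ := exists_parametrization hL hs
  refine not_isCommon_of_hasNegativeQuadSum ha hc hd hdet hb hsol ?_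
  by_cases hobs : ∃ s, SignObstruction a b c d s
  · obtain ⟨s, h⟩ := hobs
    have h2 := two_eq_zero_of_signObstruction ha hb hc hd hdet h
    obtain ⟨rfl, rfl, rfl⟩ := eq_one_add_of_signObstruction h2 h
    exact hasNegativeQuadSum_of_two_eq_zero h2 ha hb
  · exact hasNegativeQuadSum_of_forall_not_signObstruction ha hb hc hd hdet (not_exists.mp hobs)
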